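/- (Soundness and completeness of piece-rewriting) Let ℛ be a finite set of disjunctive existential rules and 𝒬 a (Boolean) UCQ. Then, for any fact base F: F, ℛ ⊨ 𝒬 if and only if there is a piece-rewriting 𝒬' of 𝒬 with ℛ such that F ⊨ 𝒬'. -/

import Mathlib

/-! ## Basic syntax: terms, atoms, substitutions -/

/-- A term over variables `V` and constants `C`. -/
inductive FOTerm (V C : Type) where
  | var (v : V)
  | const (c : C)
deriving DecidableEq

/-- An atom `p(t_1,...,t_n)`. -/
structure FOAtom (P V C : Type) where
  pred : P
  args : List (FOTerm V C)
deriving DecidableEq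

/-- A substitution of variables by terms. -/
abbrev FOSubst (V C : Type) := V → FOTerm V C

variable {P V C : Type}

def FOTerm.applySub (u : FOSubst V C) : FOTerm V C → FOTerm V C
  | FOTerm.var v => u v
  | FOTerm.const c => FOTerm.const c

def FOAtom.applySub (u : FOSubst V C) (a : FOAtom P V C) : FOAtom P V C :=
  ⟨a.pred, a.args.map (FOTerm.applySub u)⟩

def applySubFS [DecidableEq P] [DecidableEq V] [DecidableEq C]
    (u : FOSubst V C) (S : Finset (FOAtom P V C)) : Finset (FOAtom P V C) :=
  S.image (FOAtom.applySub u)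

def FOTerm.varsOf [DecidableEq V] : FOTerm V C → Finset V
  | FOTerm.var v => {v}
  | FOTerm.const _ => ∅

def FOAtom.varsOf [DecidableEq V] (a : FOAtom P V C) : Finset V :=
  a.args.foldr (fun t acc => t.varsOf ∪ acc) ∅

/-- Variables occurring in a finite set of atoms. -/
def varsFS [DecidableEq V] (S : Finset (FOAtom P V C)) : Finset V :=
  S.sup FOAtom.varsOf

/-- Terms occurring in a finite set of atoms. -/
def termsFS [DecidableEq V] [DecidableEq C] (S : Finset (FOAtom P V C)) :
    Finset (FOTerm V C) :=
  S.sup (fun a => a.args.toFinset)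

/-- `h` is a homomorphism from the atom set `S₁` to the atom set `S₂`. -/
def IsHom (h : FOSubst V C) (S₁ S₂ : Finset (FOAtom P V C)) : Prop :=
  ∀ a ∈ S₁, a.applySub h ∈ S₂

/-- `S₂ ⊨ S₁` for atom sets viewed as existentially closed conjunctions:
there is a homomorphism from `S₁` to `S₂`. -/
def EntailsFS (S₂ S₁ : Finset (FOAtom P V C)) : Prop :=
  ∃ h : FOSubst V C, IsHom h S₁ S₂

/-! ## Disjunctive existential rules, triggers, chase step α -/

/-- A disjunctive existential rule `B → H₁ ∨ ... ∨ Hₙ`. -/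
structure DisjRule (P V C : Type) where
  body : Finset (FOAtom P V C)
  heads : List (Finset (FOAtom P V C))

/-- Well-formedness: non-empty body, at least one head disjunct, non-empty disjuncts. -/
def DisjRule.WF (R : DisjRule P V C) : Prop :=
  R.body.Nonempty ∧ R.heads ≠ [] ∧ ∀ H ∈ R.heads, H.Nonempty

/-- All variables of a rule. -/
def DisjRule.vars [DecidableEq V] (R : DisjRule P V C) : Finset V :=
  varsFS R.body ∪ R.heads.foldr (fun H acc => varsFS H ∪ acc) ∅

/-- A trigger `(R, h)` on `F`: `h` is a homomorphism from the body of `R` to `F`. -/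
def IsTrigger (R : DisjRule P V C) (h : FOSubst V C) (F : Finset (FOAtom P V C)) : Prop :=
  IsHom h R.body F

/-- `h'` is a safe extension of `h` for the head disjunct `H` of rule `R` w.r.t. the
fact base `F`: it agrees with `h` outside the existential variables of `H` and renames
the existential variables of `H` injectively to fresh variables. -/
def IsSafeExt [DecidableEq V] (F : Finset (FOAtom P V C)) (R : DisjRule P V C)
    (H : Finset (FOAtom P V C)) (h h' : FOSubst V C) : Prop :=
  (∀ v : V, v ∉ varsFS H \ varsFS R.body → h' v = h v) ∧
  (∀ v ∈ varsFS H \ varsFS R.body, ∃ w : V, h' v = FOTerm.var w ∧ w ∉ varsFS F) ∧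
  (∀ v ∈ varsFS H \ varsFS R.body, ∀ v' ∈ varsFS H \ varsFS R.body,
      h' v = h' v' → v = v')

/-- `L` is a result of the application `α_∨(F, R, h)` of the trigger `(R, h)` on `F`:
its `i`-th element is `F ∪ h^{safeᵢ}(Hᵢ)`. -/
def IsAlpha [DecidableEq P] [DecidableEq V] [DecidableEq C]
    (F : Finset (FOAtom P V C)) (R : DisjRule P V C) (h : FOSubst V C)
    (L : List (Finset (FOAtom P V C))) : Prop :=
  L.length = R.heads.length ∧
  ∀ (i : ℕ) (hi : i < L.length) (hi' : i < R.heads.length),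
    ∃ h' : FOSubst V C, IsSafeExt F R (R.heads.get ⟨i, hi'⟩) h h' ∧
      L.get ⟨i, hi⟩ = F ∪ applySubFS h' (R.heads.get ⟨i, hi'⟩)

/-! ## Partitions of terms (as equivalence relations), piece-unifiers -/

/-- A relation on terms, representing a partition of a set of terms (two terms are
related iff they belong to the same class). -/
abbrev TRel (V C : Type) := FOTerm V C → FOTerm V C → Prop

/-- Admissibility of a partition: no class contains two distinct constants. -/
def RelAdmissible (r : TRel V C) : Prop :=
  ∀ c c' : C, r (FOTerm.const c) (FOTerm.const c') → c = c'

/-- `u` is a substitution associated with the partition represented by `r`: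
it is constant on classes, maps each term to a member of its class (the selected term),
and gives priority to constants. -/
def IsAssocSub (r : TRel V C) (u : FOSubst V C) : Prop :=
  (∀ s t, r s t → s.applySub u = t.applySub u) ∧
  (∀ t, r t (t.applySub u)) ∧
  (∀ (v : V) (c : C), r (FOTerm.var v) (FOTerm.const c) → u v = FOTerm.const c)

/-- The data of a piece-unifier `(Q', H', P_u)`. -/
structure PieceUnif (P V C : Type) where
  Q' : Finset (FOAtom P V C)
  H' : Finset (FOAtom P V C)
  rel : TRel V C

/-- `μ` is a piece-unifier of the CQ `Q` with the conjunctive rule `B → H`. -/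
def IsPieceUnifier [DecidableEq P] [DecidableEq V] [DecidableEq C]
    (Q : Finset (FOAtom P V C)) (B H : Finset (FOAtom P V C))
    (μ : PieceUnif P V C) : Prop :=
  μ.Q'.Nonempty ∧ μ.Q' ⊆ Q ∧ μ.H' ⊆ H ∧
  Equivalence μ.rel ∧
  -- the partition is on the terms of Q' and H' (all other classes are singletons)
  (∀ s t, μ.rel s t → s = t ∨
      (s ∈ termsFS μ.Q' ∪ termsFS μ.H' ∧ t ∈ termsFS μ.Q' ∪ termsFS μ.H')) ∧
  RelAdmissible μ.rel ∧
  -- classes containing an existential variable of H' contain otherwise only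
  -- non-separating variables of Q'
  (∀ z ∈ varsFS μ.H' \ varsFS B, ∀ t, μ.rel (FOTerm.var z) t → t = FOTerm.var z ∨
      ∃ v : V, t = FOTerm.var v ∧ FOTerm.var v ∈ termsFS μ.Q' ∧ v ∉ varsFS (Q \ μ.Q')) ∧
  -- unification condition
  (∀ u : FOSubst V C, IsAssocSub μ.rel u → applySubFS u μ.Q' = applySubFS u μ.H')

/-- The join of a list of partitions (represented as relations): the equivalence
relation generated by their union. -/
def joinRel (rs : List (TRel V C)) : TRel V C :=
  Relation.EqvGen (fun s t => ∃ r ∈ rs, r s t)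

/-- The data of a disjunctive piece-unifier: the safe copies `Q₁, ..., Qₙ` together
with the conjunctive piece-unifiers `μ₁, ..., μₙ`. -/
structure DisjPieceUnif (P V C : Type) where
  Qs : List (Finset (FOAtom P V C))
  mus : List (PieceUnif P V C)

/-- The join of the partitions of a disjunctive piece-unifier. -/
def DisjPieceUnif.rel (μ : DisjPieceUnif P V C) : TRel V C :=
  joinRel (μ.mus.map PieceUnif.rel)

/-- `Qc` is a safe copy of `Q` (bijective renaming of its variables). -/
def IsSafeCopy [DecidableEq P] [DecidableEq V] [DecidableEq C]
    (Q Qc : Finset (FOAtom P V C)) : Prop :=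
  ∃ ρ : V → V, Function.Injective ρ ∧
    Qc = Q.image (FOAtom.applySub (fun v => FOTerm.var (ρ v)))

/-- `μ` is a disjunctive piece-unifier of the UCQ `𝒬` with the disjunctive rule `R`. -/
def IsDisjPieceUnifier [DecidableEq P] [DecidableEq V] [DecidableEq C]
    (𝒬 : Set (Finset (FOAtom P V C))) (R : DisjRule P V C)
    (μ : DisjPieceUnif P V C) : Prop :=
  μ.Qs.length = R.heads.length ∧ μ.mus.length = R.heads.length ∧
  -- each Qᵢ is a safe copy of a CQ of 𝒬, with variables disjoint from the rule
  -- and from the other copies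
  (∀ (i : ℕ) (hi : i < μ.Qs.length), ∃ Q ∈ 𝒬, IsSafeCopy Q (μ.Qs.get ⟨i, hi⟩)) ∧
  (∀ (i : ℕ) (hi : i < μ.Qs.length), Disjoint (varsFS (μ.Qs.get ⟨i, hi⟩)) R.vars) ∧
  (∀ (i j : ℕ) (hi : i < μ.Qs.length) (hj : j < μ.Qs.length), i ≠ j →
      Disjoint (varsFS (μ.Qs.get ⟨i, hi⟩)) (varsFS (μ.Qs.get ⟨j, hj⟩))) ∧
  -- each μᵢ is a piece-unifier of Qᵢ with B → Hᵢ
  (∀ (i : ℕ) (hi : i < R.heads.length) (hi1 : i < μ.Qs.length) (hi2 : i < μ.mus.length),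
      IsPieceUnifier (μ.Qs.get ⟨i, hi1⟩) R.body (R.heads.get ⟨i, hi⟩)
        (μ.mus.get ⟨i, hi2⟩)) ∧
  -- the join of the partitions is admissible
  RelAdmissible μ.rel

/-- `β_∨(𝒬, R, μ) = u(B) ∪ ⋃ᵢ u(Qᵢ ∖ Qᵢ')`, for `u` a substitution associated with
the join of the partitions of `μ`. -/
def betaRw [DecidableEq P] [DecidableEq V] [DecidableEq C]
    (R : DisjRule P V C) (μ : DisjPieceUnif P V C) (u : FOSubst V C) :
    Finset (FOAtom P V C) :=
  applySubFS u R.body ∪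
    (List.zipWith (fun Qi m => applySubFS u (Qi \ PieceUnif.Q' m)) μ.Qs μ.mus).foldr
      (· ∪ ·) ∅

/-! ## Semantics -/

/-- A first-order interpretation (with non-empty domain). -/
structure Interp (P V C : Type) where
  dom : Type
  nonempty : Nonempty dom
  rel : P → List dom → Prop
  cst : C → dom

def Interp.evalT (I : Interp P V C) (a : V → I.dom) : FOTerm V C → I.dom
  | FOTerm.var v => a v
  | FOTerm.const c => I.cst c

def Interp.satAtom (I : Interp P V C) (a : V → I.dom) (atm : FOAtom P V C) : Prop :=
  I.rel atm.pred (atm.args.map (I.evalT a))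

def Interp.satFS (I : Interp P V C) (a : V → I.dom) (S : Finset (FOAtom P V C)) : Prop :=
  ∀ atm ∈ S, I.satAtom a atm

/-- `I` is a model of the atom set `S` viewed as an existentially closed conjunction. -/
def Interp.modelsFB [DecidableEq V] (I : Interp P V C) (S : Finset (FOAtom P V C)) : Prop :=
  ∃ a : V → I.dom, I.satFS a S

/-- `I` satisfies the disjunctive existential rule `R`. -/
def Interp.satRule [DecidableEq V] (I : Interp P V C) (R : DisjRule P V C) : Prop :=
  ∀ a : V → I.dom, I.satFS a R.body →
    ∃ H ∈ R.heads, ∃ a' : V → I.dom,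
      (∀ v ∈ varsFS R.body, a' v = a v) ∧ I.satFS a' H

/-- First-order entailment `F, ℛ ⊨ 𝒬` of a UCQ from a fact base and a set of
disjunctive existential rules. -/
def SemEntails [DecidableEq V] (F : Finset (FOAtom P V C)) (ℛ : Set (DisjRule P V C))
    (𝒬 : Set (Finset (FOAtom P V C))) : Prop :=
  ∀ I : Interp P V C, I.modelsFB F → (∀ R ∈ ℛ, I.satRule R) →
    ∃ Q ∈ 𝒬, I.modelsFB Q

/-! ## Piece-rewriting -/

/-- `IsPieceRewriting ℛ 𝒬 𝒬'` holds when the UCQ `𝒬'` is obtained from the UCQ `𝒬`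
by a finite sequence of one-step piece-rewritings with rules of `ℛ`. -/
inductive IsPieceRewriting [DecidableEq P] [DecidableEq V] [DecidableEq C]
    (ℛ : Set (DisjRule P V C)) :
    Finset (Finset (FOAtom P V C)) → Finset (Finset (FOAtom P V C)) → Prop
  | refl (𝒬 : Finset (Finset (FOAtom P V C))) : IsPieceRewriting ℛ 𝒬 𝒬
  | step (𝒬 𝒬' : Finset (Finset (FOAtom P V C))) (R : DisjRule P V C)
      (μ : DisjPieceUnif P V C) (u : FOSubst V C) :
      IsPieceRewriting ℛ 𝒬 𝒬' → R ∈ ℛ →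
      IsDisjPieceUnifier (↑𝒬' : Set (Finset (FOAtom P V C))) R μ →
      IsAssocSub μ.rel u →
      IsPieceRewriting ℛ 𝒬 (insert (betaRw R μ u) 𝒬')

theorem FOAtom.mem_varsOf [DecidableEq V] {a : FOAtom P V C} {v : V} :
    v ∈ a.varsOf ↔ FOTerm.var v ∈ a.args := by
  obtain ⟨p, l⟩ := a
  unfold FOAtom.varsOf
  induction l with
  | nil => simp
  | cons t l ih =>
    cases t <;> simp_all [FOTerm.varsOf]

theorem mem_varsFS [DecidableEq V] {S : Finset (FOAtom P V C)} {v : V} :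
    v ∈ varsFS S ↔ ∃ a ∈ S, FOTerm.var v ∈ a.args := by
  simp [varsFS, Finset.mem_sup, FOAtom.mem_varsOf]

theorem mem_termsFS [DecidableEq V] [DecidableEq C] {S : Finset (FOAtom P V C)}
    {t : FOTerm V C} : t ∈ termsFS S ↔ ∃ a ∈ S, t ∈ a.args := by
  simp [termsFS, Finset.mem_sup]

theorem varsFS_mono [DecidableEq V] {S T : Finset (FOAtom P V C)} (h : S ⊆ T) :
    varsFS S ⊆ varsFS T :=
  Finset.sup_mono h

theorem DisjRule.body_vars_subset [DecidableEq V] (R : DisjRule P V C) :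
    varsFS R.body ⊆ R.vars :=
  Finset.subset_union_left

theorem DisjRule.head_vars_subset [DecidableEq V] (R : DisjRule P V C)
    {H : Finset (FOAtom P V C)} (hH : H ∈ R.heads) : varsFS H ⊆ R.vars := by
  refine subset_trans ?_ Finset.subset_union_right
  generalize R.heads = heads at hH ⊢
  induction heads with
  | nil => simp at hH
  | cons K l ih =>
    rcases List.mem_cons.1 hH with rfl | h
    · exact Finset.subset_union_left
    · exact (ih h).trans Finset.subset_union_right

/-! ## Substitutions -/

theorem List.map_eq_map_of_rel {α β γ : Type*} {f : α → β} {F G : α → γ} {l l' : List α}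
    (h : l.map f = l'.map f) (hFG : ∀ x ∈ l, ∀ y ∈ l', f x = f y → F x = G y) :
    l.map F = l'.map G := by
  induction l generalizing l' with
  | nil => cases l' <;> simp_all
  | cons x l ih =>
    cases l' with
    | nil => simp at h
    | cons y l' =>
      simp only [List.map_cons, List.cons.injEq] at h ⊢
      exact ⟨hFG x (by simp) y (by simp) h.1,
        ih h.2 fun x hx y hy => hFG x (by simp [hx]) y (by simp [hy])⟩

theorem FOTerm.applySub_var (t : FOTerm V C) : t.applySub FOTerm.var = t := by
  cases t <;> rfl

theorem FOAtom.applySub_var (a : FOAtom P V C) : a.applySub FOTerm.var = a := by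
  obtain ⟨p, l⟩ := a
  have : FOTerm.applySub (FOTerm.var : FOSubst V C) = id := funext FOTerm.applySub_var
  simp [FOAtom.applySub, this]

theorem FOTerm.applySub_applySub (u w : FOSubst V C) (t : FOTerm V C) :
    (t.applySub u).applySub w = t.applySub (fun v => (u v).applySub w) := by
  cases t <;> rfl

theorem FOAtom.applySub_applySub (u w : FOSubst V C) (a : FOAtom P V C) :
    (a.applySub u).applySub w = a.applySub (fun v => (u v).applySub w) := by
  simp [FOAtom.applySub, Function.comp_def, FOTerm.applySub_applySub]

theorem FOAtom.applySub_congr {u w : FOSubst V C} {a : FOAtom P V C}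
    (h : ∀ v, FOTerm.var v ∈ a.args → u v = w v) : a.applySub u = a.applySub w := by
  simp only [FOAtom.applySub, FOAtom.mk.injEq, true_and]
  refine List.map_congr_left fun t ht => ?_
  cases t with
  | var v => exact h v ht
  | const c => rfl

theorem mem_args_applySub {u : FOSubst V C} {a : FOAtom P V C} {t : FOTerm V C}
    (ht : t ∈ a.args) : t.applySub u ∈ (a.applySub u).args :=
  List.mem_map_of_mem ht

theorem mem_applySubFS [DecidableEq P] [DecidableEq V] [DecidableEq C]
    {u : FOSubst V C} {S : Finset (FOAtom P V C)} {a : FOAtom P V C} :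
    a ∈ applySubFS u S ↔ ∃ b ∈ S, b.applySub u = a := by
  simp [applySubFS]

/-- Every admissible partition has an associated substitution. -/
theorem exists_isAssocSub {r : TRel V C} (hr : Equivalence r) (ha : RelAdmissible r) :
    ∃ u : FOSubst V C, IsAssocSub r u := by
  classical
  let S : Setoid (FOTerm V C) := ⟨r, hr⟩
  let pick : FOTerm V C → FOTerm V C := fun t =>
    if h : ∃ c, r t (FOTerm.const c) then FOTerm.const h.choose
    else (Quotient.mk S t).out
  have pick_rel : ∀ t, r t (pick t) := fun t => by
    by_cases h : ∃ c, r t (FOTerm.const c)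
    · simpa only [pick, dif_pos h] using h.choose_spec
    · simp only [pick, dif_neg h]
      exact hr.symm (Quotient.exact (Quotient.out_eq (Quotient.mk S t)))
  have pick_const : ∀ t c, r t (FOTerm.const c) → pick t = FOTerm.const c := fun t c h => by
    have h' : ∃ c, r t (FOTerm.const c) := ⟨c, h⟩
    simp only [pick, dif_pos h']
    rw [ha _ _ (hr.trans (hr.symm h'.choose_spec) h)]
  have pick_congr : ∀ s t, r s t → pick s = pick t := fun s t h => by
    by_cases h' : ∃ c, r t (FOTerm.const c)
    · obtain ⟨c, hc⟩ := h'
      rw [pick_const t c hc, pick_const s c (hr.trans h hc)]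
    · have h'' : ¬ ∃ c, r s (FOTerm.const c) := fun ⟨c, hc⟩ => h' ⟨c, hr.trans (hr.symm h) hc⟩
      simp only [pick, dif_neg h', dif_neg h'']
      exact congrArg Quotient.out (Quotient.sound (s := S) h)
  have apply_eq : ∀ t : FOTerm V C, t.applySub (fun v => pick (FOTerm.var v)) = pick t := by
    intro t
    cases t with
    | var v => rfl
    | const c => exact (pick_const _ c (hr.refl _)).symm
  refine ⟨fun v => pick (FOTerm.var v), fun s t h => ?_, fun t => ?_, fun v c h => ?_⟩
  · rw [apply_eq, apply_eq, pick_congr s t h]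
  · rw [apply_eq]; exact pick_rel t
  · exact pick_const _ c h

theorem mem_betaRw [DecidableEq P] [DecidableEq V] [DecidableEq C]
    {R : DisjRule P V C} {μ : DisjPieceUnif P V C} {u : FOSubst V C} {a : FOAtom P V C} :
    a ∈ betaRw R μ u ↔ (∃ b ∈ R.body, b.applySub u = a) ∨
      ∃ (i : ℕ) (h₁ : i < μ.Qs.length) (h₂ : i < μ.mus.length),
        ∃ b ∈ μ.Qs.get ⟨i, h₁⟩ \ (μ.mus.get ⟨i, h₂⟩).Q', b.applySub u = a := by
  have mem_foldr : ∀ l : List (Finset (FOAtom P V C)),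
      a ∈ l.foldr (· ∪ ·) ∅ ↔ ∃ S ∈ l, a ∈ S := by
    intro l
    induction l <;> simp_all
  rw [betaRw, Finset.mem_union, mem_applySubFS, mem_foldr]
  refine or_congr_right ⟨?_, ?_⟩
  · rintro ⟨S, hS, ha⟩
    obtain ⟨i, hi, rfl⟩ := List.mem_iff_getElem.1 hS
    rw [List.getElem_zipWith, mem_applySubFS] at ha
    rw [List.length_zipWith, lt_min_iff] at hi
    exact ⟨i, hi.1, hi.2, ha⟩
  · rintro ⟨i, h₁, h₂, ha⟩
    refine ⟨_, List.getElem_mem (n := i) (by simp; exact ⟨h₁, h₂⟩), ?_⟩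
    rw [List.getElem_zipWith, mem_applySubFS]
    exact ha

/-! ## Soundness -/

theorem Interp.evalT_applySub (I : Interp P V C) (a : V → I.dom) (u : FOSubst V C)
    (t : FOTerm V C) : I.evalT a (t.applySub u) = I.evalT (fun v => I.evalT a (u v)) t := by
  cases t <;> rfl

theorem Interp.satAtom_applySub (I : Interp P V C) (a : V → I.dom) (u : FOSubst V C)
    (b : FOAtom P V C) :
    I.satAtom a (b.applySub u) ↔ I.satAtom (fun v => I.evalT a (u v)) b := by
  simp [Interp.satAtom, FOAtom.applySub, Function.comp_def, Interp.evalT_applySub]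

theorem Interp.modelsFB_of_entailsFS [DecidableEq V] {I : Interp P V C}
    {S T : Finset (FOAtom P V C)} (h : EntailsFS S T) (hS : I.modelsFB S) : I.modelsFB T := by
  obtain ⟨g, hg⟩ := h
  obtain ⟨a, ha⟩ := hS
  exact ⟨_, fun b hb => (I.satAtom_applySub a g b).1 (ha _ (hg b hb))⟩

/-- If the body of the rule and the part of `Q` left by a piece-unifier hold under
`a ∘ u`, and the head `H` holds under an extension of `a ∘ u`, then `Q` holds. -/
theorem IsPieceUnifier.modelsFB [DecidableEq P] [DecidableEq V] [DecidableEq C]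
    {Q B H : Finset (FOAtom P V C)} {μ : PieceUnif P V C} (hμ : IsPieceUnifier Q B H μ)
    (hQB : Disjoint (varsFS Q) (varsFS B)) (hQH : Disjoint (varsFS Q) (varsFS H))
    {u : FOSubst V C} (hu : ∀ s t, μ.rel s t → s.applySub u = t.applySub u)
    {I : Interp P V C} {a a' : V → I.dom}
    (hrest : ∀ b ∈ Q \ μ.Q', I.satAtom a (b.applySub u))
    (ha' : ∀ v ∈ varsFS B, a' v = I.evalT a (u v)) (hH : I.satFS a' H) :
    I.modelsFB Q := by
  classical
  obtain ⟨-, hQ', hH', heq, -, hadm, hex, huni⟩ := hμ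
  obtain ⟨w, hw⟩ := exists_isAssocSub heq hadm
  have not_mem_Q' : ∀ z, z ∈ varsFS μ.H' ∪ varsFS B → FOTerm.var z ∉ termsFS μ.Q' := by
    intro z hz hzQ
    obtain ⟨b, hb, hzb⟩ := mem_termsFS.1 hzQ
    have hzQ : z ∈ varsFS Q := mem_varsFS.2 ⟨b, hQ' hb, hzb⟩
    rcases Finset.mem_union.1 hz with h | h
    · exact Finset.disjoint_left.1 hQH hzQ (varsFS_mono hH' h)
    · exact Finset.disjoint_left.1 hQB hzQ h
  let b : V → I.dom := fun v =>
    if h : ∃ z ∈ varsFS μ.H' \ varsFS B, μ.rel (FOTerm.var z) (FOTerm.var v)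
    then a' h.choose else I.evalT a (u v)
  have b_ex : ∀ v, ∀ z ∈ varsFS μ.H' \ varsFS B, μ.rel (FOTerm.var z) (FOTerm.var v) →
      b v = a' z := by
    intro v z hz hzv
    have h : ∃ z ∈ varsFS μ.H' \ varsFS B, μ.rel (FOTerm.var z) (FOTerm.var v) := ⟨z, hz, hzv⟩
    simp only [b, dif_pos h]
    obtain ⟨hc, hcv⟩ := h.choose_spec
    rcases hex z hz _ (heq.trans hzv (heq.symm hcv)) with e | ⟨v', e, hv', -⟩
    · rw [FOTerm.var.inj e]
    · rw [← e] at hv'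
      exact absurd hv' (not_mem_Q' _ (Finset.mem_union_left _ (Finset.mem_sdiff.1 hc).1))
  have b_of_not : ∀ t : FOTerm V C,
      (∀ z ∈ varsFS μ.H' \ varsFS B, ¬ μ.rel (FOTerm.var z) t) →
      I.evalT b t = I.evalT a (t.applySub u) := by
    intro t ht
    cases t with
    | const c => rfl
    | var v =>
      have h : ¬ ∃ z ∈ varsFS μ.H' \ varsFS B, μ.rel (FOTerm.var z) (FOTerm.var v) :=
        fun ⟨z, hz, hzv⟩ => ht z hz hzv
      simp only [Interp.evalT, b, dif_neg h, FOTerm.applySub]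
  refine ⟨b, fun q hq => ?_⟩
  by_cases hqQ : q ∈ μ.Q'
  · obtain ⟨c, hc, hcq⟩ := mem_applySubFS.1 (huni w hw ▸ mem_applySubFS.2 ⟨q, hqQ, rfl⟩)
    have hpred : c.pred = q.pred := (FOAtom.mk.inj hcq).1
    have hargs : q.args.map (FOTerm.applySub w) = c.args.map (FOTerm.applySub w) :=
      (congrArg FOAtom.args hcq).symm
    have key : q.args.map (I.evalT b) = c.args.map (I.evalT a') := by
      refine List.map_eq_map_of_rel hargs fun t ht s hs hts => ?_
      have hrel : μ.rel s t := heq.symm (heq.trans (hw.2.1 t) (hts ▸ heq.symm (hw.2.1 s)))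
      by_cases hs_ex : ∃ z ∈ varsFS μ.H' \ varsFS B, s = FOTerm.var z
      · obtain ⟨z, hz, rfl⟩ := hs_ex
        rcases hex z hz t hrel with rfl | ⟨v, rfl, -, -⟩
        · exact absurd (mem_termsFS.2 ⟨q, hqQ, ht⟩)
            (not_mem_Q' _ (Finset.mem_union_left _ (Finset.mem_sdiff.1 hz).1))
        · exact b_ex v z hz hrel
      · have hsB : ∀ x, s = FOTerm.var x → x ∈ varsFS B := by
          rintro x rfl
          by_contra hx
          exact hs_ex ⟨x, Finset.mem_sdiff.2 ⟨mem_varsFS.2 ⟨c, hc, hs⟩, hx⟩, rfl⟩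
        rw [b_of_not, ← hu s t hrel]
        · cases s with
          | const c => rfl
          | var x => exact (ha' x (hsB x rfl)).symm
        · intro z hz hzt
          rcases hex z hz s (heq.trans hzt (heq.symm hrel)) with e | ⟨v, e, hv, -⟩
          · exact (Finset.mem_sdiff.1 hz).2 (hsB z e)
          · exact not_mem_Q' v (Finset.mem_union_right _ (hsB v e)) hv
    have := hH c (hH' hc)
    rw [Interp.satAtom] at this ⊢
    rwa [key, ← hpred]
  · have hq' : q ∈ Q \ μ.Q' := Finset.mem_sdiff.2 ⟨hq, hqQ⟩
    have : q.args.map (I.evalT b) = q.args.map (fun t => I.evalT a (t.applySub u)) := by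
      refine List.map_congr_left fun t ht => b_of_not t fun z hz hzt => ?_
      rcases hex z hz t hzt with rfl | ⟨v, rfl, -, hv⟩
      · exact Finset.disjoint_left.1 hQH (mem_varsFS.2 ⟨q, hq, ht⟩)
          (varsFS_mono hH' (Finset.mem_sdiff.1 hz).1)
      · exact hv (mem_varsFS.2 ⟨q, hq', ht⟩)
    have hsat := hrest q hq'
    rw [Interp.satAtom] at hsat ⊢
    rw [this]
    simpa [FOAtom.applySub, Function.comp_def] using hsat

theorem IsSafeCopy.entailsFS [DecidableEq P] [DecidableEq V] [DecidableEq C]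
    {Q Qc : Finset (FOAtom P V C)} (h : IsSafeCopy Q Qc) : EntailsFS Qc Q := by
  obtain ⟨ρ, -, rfl⟩ := h
  exact ⟨_, fun b hb => Finset.mem_image_of_mem _ hb⟩

/-- A one-step rewriting is sound. -/
theorem IsDisjPieceUnifier.sound [DecidableEq P] [DecidableEq V] [DecidableEq C]
    {𝒬 : Set (Finset (FOAtom P V C))} {R : DisjRule P V C} {μ : DisjPieceUnif P V C}
    (hμ : IsDisjPieceUnifier 𝒬 R μ) {u : FOSubst V C} (hu : IsAssocSub μ.rel u)
    {I : Interp P V C} (hR : I.satRule R) (hI : I.modelsFB (betaRw R μ u)) :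
    ∃ Q ∈ 𝒬, I.modelsFB Q := by
  obtain ⟨hlQ, hlm, hcopy, hdisj, -, hpu, -⟩ := hμ
  obtain ⟨a, ha⟩ := hI
  obtain ⟨H, hH, a', ha', hsat⟩ := hR (fun v => I.evalT a (u v)) fun b hb =>
    (I.satAtom_applySub a u b).1 (ha _ (mem_betaRw.2 (Or.inl ⟨b, hb, rfl⟩)))
  obtain ⟨i, hi, rfl⟩ := List.mem_iff_getElem.1 hH
  have h₁ : i < μ.Qs.length := hlQ ▸ hi
  have h₂ : i < μ.mus.length := hlm ▸ hi
  obtain ⟨Q, hQ, hc⟩ := hcopy i h₁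
  refine ⟨Q, hQ, Interp.modelsFB_of_entailsFS hc.entailsFS ?_⟩
  refine (hpu i hi h₁ h₂).modelsFB ((hdisj i h₁).mono_right R.body_vars_subset)
    ((hdisj i h₁).mono_right (R.head_vars_subset hH)) (fun s t hst => hu.1 s t ?_)
    (fun b hb => ha _ (mem_betaRw.2 (Or.inr ⟨i, h₁, h₂, b, hb, rfl⟩))) ha' hsat
  exact Relation.EqvGen.rel _ _ ⟨_, List.mem_map_of_mem (List.get_mem μ.mus ⟨i, h₂⟩), hst⟩

theorem IsPieceRewriting.sound [DecidableEq P] [DecidableEq V] [DecidableEq C]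
    {ℛ : Set (DisjRule P V C)} {𝒬 𝒬' : Finset (Finset (FOAtom P V C))}
    (h : IsPieceRewriting ℛ 𝒬 𝒬') {I : Interp P V C} (hI : ∀ R ∈ ℛ, I.satRule R)
    (hQ : ∃ Q ∈ 𝒬', I.modelsFB Q) : ∃ Q ∈ 𝒬, I.modelsFB Q := by
  induction h with
  | refl => exact hQ
  | step 𝒬' R μ u _ hR hμ hu ih =>
    obtain ⟨Q, hQ, hmod⟩ := hQ
    rcases Finset.mem_insert.1 hQ with rfl | hQ
    · exact ih (hμ.sound hu (hI R hR) hmod)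
    · exact ih ⟨Q, hQ, hmod⟩

/-! ## Combining rewritings -/

theorem IsDisjPieceUnifier.mono [DecidableEq P] [DecidableEq V] [DecidableEq C]
    {𝒬 𝒬' : Set (Finset (FOAtom P V C))} {R : DisjRule P V C} {μ : DisjPieceUnif P V C}
    (h : IsDisjPieceUnifier 𝒬 R μ) (hsub : 𝒬 ⊆ 𝒬') : IsDisjPieceUnifier 𝒬' R μ := by
  obtain ⟨h₁, h₂, h₃, h₄⟩ := h
  exact ⟨h₁, h₂, fun i hi => (h₃ i hi).imp fun Q hQ => ⟨hsub hQ.1, hQ.2⟩, h₄⟩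

theorem IsPieceRewriting.subset [DecidableEq P] [DecidableEq V] [DecidableEq C]
    {ℛ : Set (DisjRule P V C)} {𝒬 𝒬' : Finset (Finset (FOAtom P V C))}
    (h : IsPieceRewriting ℛ 𝒬 𝒬') : 𝒬 ⊆ 𝒬' := by
  induction h with
  | refl => exact subset_rfl
  | step _ _ _ _ _ _ _ _ ih => exact ih.trans (Finset.subset_insert _ _)

theorem IsPieceRewriting.directed [DecidableEq P] [DecidableEq V] [DecidableEq C]
    {ℛ : Set (DisjRule P V C)} {𝒬 𝒜 ℬ : Finset (Finset (FOAtom P V C))}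
    (hA : IsPieceRewriting ℛ 𝒬 𝒜) (hB : IsPieceRewriting ℛ 𝒬 ℬ) :
    ∃ 𝒟, IsPieceRewriting ℛ 𝒬 𝒟 ∧ 𝒜 ⊆ 𝒟 ∧ ℬ ⊆ 𝒟 := by
  induction hB with
  | refl => exact ⟨𝒜, hA, subset_rfl, hA.subset⟩
  | step ℬ R μ u _ hR hμ hu ih =>
    obtain ⟨𝒟, hD, hAD, hBD⟩ := ih
    exact ⟨_, .step _ _ R μ u hD hR (hμ.mono (Finset.coe_subset.2 hBD)) hu,
      hAD.trans (Finset.subset_insert _ _), Finset.insert_subset_insert _ hBD⟩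

/-- The CQs occurring in some piece-rewriting of `𝒬` with `ℛ`. -/
def IsRewritingCQ [DecidableEq P] [DecidableEq V] [DecidableEq C]
    (ℛ : Set (DisjRule P V C)) (𝒬 : Finset (Finset (FOAtom P V C)))
    (Q : Finset (FOAtom P V C)) : Prop :=
  ∃ 𝒬', IsPieceRewriting ℛ 𝒬 𝒬' ∧ Q ∈ 𝒬'

theorem exists_common_rewriting [DecidableEq P] [DecidableEq V] [DecidableEq C]
    {ℛ : Set (DisjRule P V C)} {𝒬 : Finset (Finset (FOAtom P V C))} {ι : Type*}
    (s : Finset ι) (Q : ι → Finset (FOAtom P V C)) (hQ : ∀ i, IsRewritingCQ ℛ 𝒬 (Q i)) :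
    ∃ 𝒟, IsPieceRewriting ℛ 𝒬 𝒟 ∧ ∀ i ∈ s, Q i ∈ 𝒟 := by
  classical
  induction s using Finset.induction_on with
  | empty => exact ⟨𝒬, .refl 𝒬, by simp⟩
  | insert i s _ ih =>
    obtain ⟨𝒟, hD, hs⟩ := ih
    obtain ⟨𝒜, hA, hi⟩ := hQ i
    obtain ⟨ℰ, hE, hDE, hAE⟩ := hD.directed hA
    refine ⟨ℰ, hE, fun j hj => ?_⟩
    rcases Finset.mem_insert.1 hj with rfl | hj
    · exact hAE hi
    · exact hDE (hs j hj)

/-! ## Completeness -/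

/-- In an infinite type one can find countably many disjoint copies of the type
avoiding a given finite set. -/
theorem exists_injective_prod_avoiding [Infinite V] (S : Finset V) :
    ∃ e : ℕ × V → V, Function.Injective e ∧ ∀ x, e x ∉ S := by
  have h : Cardinal.mk (ℕ × V) = Cardinal.mk ((S : Set V)ᶜ : Set V) := by
    rw [Cardinal.mk_compl_finset_of_infinite, Cardinal.mk_prod]
    simp [Cardinal.aleph0_mul_eq (Cardinal.aleph0_le_mk V)]
  obtain ⟨f⟩ := Cardinal.eq.1 h
  exact ⟨fun x => (f x).1, Subtype.val_injective.comp f.injective, fun x => (f x).2⟩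

/-- The atoms of `Q` that `φ` does not send to `F`. -/
def unifiedAtoms [DecidableEq P] [DecidableEq V] [DecidableEq C] (φ : FOSubst V C)
    (F Q : Finset (FOAtom P V C)) : Finset (FOAtom P V C) :=
  Q.filter fun a => a.applySub φ ∉ F

/-- The piece-unifier induced by a substitution `φ` sending `Q` to `F ∪ φ(H)`: it
unifies the atoms of `Q` not sent to `F` with the atoms of `H` having the same image. -/
def inducedUnif [DecidableEq P] [DecidableEq V] [DecidableEq C] (φ : FOSubst V C)
    (F Q H : Finset (FOAtom P V C)) : PieceUnif P V C where
  Q' := unifiedAtoms φ F Q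
  H' := H.filter fun b => b.applySub φ ∈ applySubFS φ (unifiedAtoms φ F Q)
  rel s t := s = t ∨
    (s ∈ termsFS (unifiedAtoms φ F Q) ∪
        termsFS (H.filter fun b => b.applySub φ ∈ applySubFS φ (unifiedAtoms φ F Q)) ∧
      t ∈ termsFS (unifiedAtoms φ F Q) ∪
        termsFS (H.filter fun b => b.applySub φ ∈ applySubFS φ (unifiedAtoms φ F Q))) ∧
    s.applySub φ = t.applySub φ

theorem inducedUnif_rel_applySub [DecidableEq P] [DecidableEq V] [DecidableEq C]
    {φ : FOSubst V C} {F Q H : Finset (FOAtom P V C)} {s t : FOTerm V C}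
    (h : (inducedUnif φ F Q H).rel s t) : s.applySub φ = t.applySub φ := by
  rcases h with rfl | h
  · rfl
  · exact h.2

theorem isPieceUnifier_inducedUnif [DecidableEq P] [DecidableEq V] [DecidableEq C]
    {φ : FOSubst V C} {F Q B H : Finset (FOAtom P V C)}
    (hQ : ∀ a ∈ Q, a.applySub φ ∈ F ∪ applySubFS φ H) (hQF : ¬ IsHom φ Q F)
    (hB : IsHom φ B F)
    (hfresh : ∀ z ∈ varsFS H \ varsFS B, ∃ w, φ z = FOTerm.var w ∧ w ∉ varsFS F)
    (hinj : ∀ z ∈ varsFS H \ varsFS B, ∀ z' ∈ varsFS H \ varsFS B, φ z = φ z' → z = z') :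
    IsPieceUnifier Q B H (inducedUnif φ F Q H) := by
  have not_fresh : ∀ a : FOAtom P V C, a.applySub φ ∈ F → ∀ v, FOTerm.var v ∈ a.args →
      ∀ z ∈ varsFS H \ varsFS B, φ z ≠ φ v := by
    intro a ha v hv z hz e
    obtain ⟨w, hw, hwF⟩ := hfresh z hz
    refine hwF (mem_varsFS.2 ⟨_, ha, ?_⟩)
    have := mem_args_applySub (u := φ) hv
    rwa [FOTerm.applySub, ← e, hw] at this
  refine ⟨?_, Finset.filter_subset _ _, Finset.filter_subset _ _, ⟨fun _ => Or.inl rfl, ?_, ?_⟩,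
    ?_, ?_, ?_, ?_⟩
  · unfold IsHom at hQF
    push Not at hQF
    obtain ⟨a, ha, haF⟩ := hQF
    exact ⟨a, Finset.mem_filter.2 ⟨ha, haF⟩⟩
  · rintro s t (rfl | ⟨⟨hs, ht⟩, e⟩)
    · exact Or.inl rfl
    · exact Or.inr ⟨⟨ht, hs⟩, e.symm⟩
  · rintro s t r (rfl | ⟨⟨hs, ht⟩, e⟩) h
    · exact h
    · rcases h with rfl | ⟨⟨_, hr⟩, e'⟩
      · exact Or.inr ⟨⟨hs, ht⟩, e⟩
      · exact Or.inr ⟨⟨hs, hr⟩, e.trans e'⟩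
  · rintro s t (rfl | h)
    · exact Or.inl rfl
    · exact Or.inr h.1
  · intro c c' h
    exact FOTerm.const.inj (inducedUnif_rel_applySub h)
  · intro z hz t ht
    have hz : z ∈ varsFS H \ varsFS B :=
      Finset.sdiff_subset_sdiff (varsFS_mono (Finset.filter_subset _ _)) subset_rfl hz
    rcases ht with rfl | ⟨⟨-, ht⟩, e⟩
    · exact Or.inl rfl
    · cases t with
      | const c =>
        obtain ⟨w, hw, -⟩ := hfresh z hz
        rw [FOTerm.applySub, hw] at e
        exact absurd e (by simp [FOTerm.applySub])
      | var v =>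
        have notBody : ∀ b ∈ B, FOTerm.var v ∉ b.args := fun b hb hv =>
          not_fresh b (hB b hb) v hv z hz e
        rcases Finset.mem_union.1 ht with h | h
        · refine Or.inr ⟨v, rfl, h, fun hv => ?_⟩
          obtain ⟨a, ha, hva⟩ := mem_varsFS.1 hv
          obtain ⟨haQ, ha'⟩ := Finset.mem_sdiff.1 ha
          refine not_fresh a ?_ v hva z hz e
          by_contra haF
          exact ha' (Finset.mem_filter.2 ⟨haQ, haF⟩)
        · obtain ⟨b, hb, hvb⟩ := mem_termsFS.1 h
          have hv : v ∈ varsFS H \ varsFS B := by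
            refine Finset.mem_sdiff.2 ⟨mem_varsFS.2 ⟨b, (Finset.mem_filter.1 hb).1, hvb⟩, ?_⟩
            intro hv
            obtain ⟨b, hb, hvb⟩ := mem_varsFS.1 hv
            exact notBody b hb hvb
          exact Or.inl (congrArg _ (hinj z hz v hv e).symm)
  · intro u hu
    have unify : ∀ a ∈ (inducedUnif φ F Q H).Q', ∀ b ∈ (inducedUnif φ F Q H).H',
        a.applySub φ = b.applySub φ → a.applySub u = b.applySub u := by
      intro a ha b hb e
      have h : a.args.map (FOTerm.applySub u) = b.args.map (FOTerm.applySub u) :=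
        List.map_eq_map_of_rel (congrArg FOAtom.args e) fun s hs t ht hst =>
          hu.1 s t (Or.inr ⟨⟨Finset.mem_union_left _ (mem_termsFS.2 ⟨a, ha, hs⟩),
            Finset.mem_union_right _ (mem_termsFS.2 ⟨b, hb, ht⟩)⟩, hst⟩)
      have hp : a.pred = b.pred := (FOAtom.mk.inj e).1
      simp only [FOAtom.applySub, h, hp]
    ext c
    rw [mem_applySubFS, mem_applySubFS]
    constructor
    · rintro ⟨a, ha, rfl⟩
      obtain ⟨haQ, haF⟩ := Finset.mem_filter.1 ha
      obtain ⟨b, hb, e⟩ :=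
        mem_applySubFS.1 ((Finset.mem_union.1 (hQ a haQ)).resolve_left haF)
      have hb' : b ∈ (inducedUnif φ F Q H).H' :=
        Finset.mem_filter.2 ⟨hb, mem_applySubFS.2 ⟨a, ha, e.symm⟩⟩
      exact ⟨b, hb', (unify a ha b hb' e.symm).symm⟩
    · rintro ⟨b, hb, rfl⟩
      obtain ⟨a, ha, e⟩ := mem_applySubFS.1 (Finset.mem_filter.1 hb).2
      exact ⟨a, ha, unify a ha b hb e⟩

theorem applySub_eq_of_joinRel {rs : List (TRel V C)} {φ : FOSubst V C}
    (h : ∀ r ∈ rs, ∀ s t, r s t → s.applySub φ = t.applySub φ) {s t : FOTerm V C}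
    (hst : joinRel rs s t) : s.applySub φ = t.applySub φ := by
  induction hst with
  | rel _ _ h' => obtain ⟨r, hr, h'⟩ := h'; exact h r hr _ _ h'
  | refl => rfl
  | symm _ _ _ ih => exact ih.symm
  | trans _ _ _ _ _ ih₁ ih₂ => exact ih₁.trans ih₂

/-- `F` satisfies no CQ of any piece-rewriting of `𝒬` with `ℛ`. -/
def AvoidsRewritings [DecidableEq P] [DecidableEq V] [DecidableEq C]
    (ℛ : Set (DisjRule P V C)) (𝒬 : Finset (Finset (FOAtom P V C)))
    (F : Finset (FOAtom P V C)) : Prop :=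
  ∀ Q, IsRewritingCQ ℛ 𝒬 Q → ¬ EntailsFS F Q

/-- Any trigger on a fact base avoiding all rewritings can be satisfied in some larger
fact base avoiding all rewritings. -/
theorem AvoidsRewritings.exists_extension [DecidableEq P] [DecidableEq V] [DecidableEq C]
    [Infinite V] {ℛ : Set (DisjRule P V C)} {𝒬 : Finset (Finset (FOAtom P V C))}
    {F : Finset (FOAtom P V C)} (hF : AvoidsRewritings ℛ 𝒬 F) {R : DisjRule P V C}
    (hR : R ∈ ℛ) {h : FOSubst V C} (hh : IsTrigger R h F) :
    ∃ G, F ⊆ G ∧ AvoidsRewritings ℛ 𝒬 G ∧ ∃ H ∈ R.heads, ∃ h' : FOSubst V C,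
      (∀ v ∈ varsFS R.body, h' v = h v) ∧ IsHom h' H G := by
  classical
  obtain ⟨f, hf, hfF⟩ := exists_injective_prod_avoiding (varsFS F)
  obtain ⟨e, he, heR⟩ := exists_injective_prod_avoiding R.vars
  let h' : FOSubst V C := fun v => if v ∈ varsFS R.body then h v else FOTerm.var (f (0, v))
  have h'_body : ∀ v ∈ varsFS R.body, h' v = h v := fun v hv => if_pos hv
  have h'_ex : ∀ v, v ∉ varsFS R.body → h' v = FOTerm.var (f (0, v)) := fun v hv => if_neg hv
  by_contra hcon
  have hbad : ∀ i : Fin R.heads.length, ∃ Q, IsRewritingCQ ℛ 𝒬 Q ∧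
      EntailsFS (F ∪ applySubFS h' (R.heads.get i)) Q := by
    intro i
    by_contra hi
    push Not at hi
    exact hcon ⟨_, Finset.subset_union_left, hi, _, List.get_mem _ i, h', h'_body,
      fun a ha => Finset.mem_union_right _ (mem_applySubFS.2 ⟨a, ha, rfl⟩)⟩
  choose Q hQ g hg using hbad
  obtain ⟨𝒟, hD, hQD⟩ := exists_common_rewriting Finset.univ Q hQ
  -- a single substitution acting as `g i` on the `i`-th copy and as `h'` on the rule
  obtain ⟨φ, hφcopy, hφR⟩ : ∃ φ : FOSubst V C,
      (∀ (i : Fin R.heads.length) v, φ (e (i, v)) = g i v) ∧ ∀ v ∈ R.vars, φ v = h' v := by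
    refine ⟨fun v => if hv : ∃ x : Fin R.heads.length × V, e (x.1, x.2) = v
      then g hv.choose.1 hv.choose.2 else h' v, fun i v => ?_, fun v hv => ?_⟩
    · have hv : ∃ x : Fin R.heads.length × V, e (x.1, x.2) = e (i, v) := ⟨(i, v), rfl⟩
      have hs := he hv.choose_spec
      simp only [Prod.mk.injEq, Fin.val_inj] at hs
      simp only [dif_pos hv]
      rw [hs.1, hs.2]
    · have hv' : ¬ ∃ x : Fin R.heads.length × V, e (x.1, x.2) = v := by
        rintro ⟨x, rfl⟩
        exact heR _ hv
      simp only [dif_neg hv']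
  let copy : Fin R.heads.length → Finset (FOAtom P V C) := fun i =>
    (Q i).image (FOAtom.applySub fun v => FOTerm.var (e (i, v)))
  have copy_vars : ∀ i, ∀ v ∈ varsFS (copy i), ∃ w, v = e (i, w) := by
    intro i v hv
    obtain ⟨a, ha, hva⟩ := mem_varsFS.1 hv
    obtain ⟨b, -, rfl⟩ := Finset.mem_image.1 ha
    obtain ⟨t, -, ht⟩ := List.mem_map.1 hva
    cases t with
    | var w => exact ⟨w, (FOTerm.var.inj ht).symm⟩
    | const c => simp [FOTerm.applySub] at ht
  have φ_copy : ∀ i (b : FOAtom P V C),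
      (b.applySub fun v => FOTerm.var (e (i.1, v))).applySub φ = b.applySub (g i) := by
    intro i b
    rw [FOAtom.applySub_applySub]
    exact FOAtom.applySub_congr fun v _ => hφcopy i v
  have φ_head : ∀ H ∈ R.heads, applySubFS φ H = applySubFS h' H := fun H hH =>
    Finset.image_congr fun a ha => FOAtom.applySub_congr fun v hv =>
      hφR v (R.head_vars_subset hH (mem_varsFS.2 ⟨a, ha, hv⟩))
  have φ_body : IsHom φ R.body F := fun a ha => by
    rw [FOAtom.applySub_congr (w := h) fun v hv => ?_]
    · exact hh a ha
    · have hv' := mem_varsFS.2 ⟨a, ha, hv⟩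
      rw [hφR v (R.body_vars_subset hv'), h'_body v hv']
  let unif : Fin R.heads.length → PieceUnif P V C := fun i =>
    inducedUnif φ F (copy i) (R.heads.get i)
  let μ : DisjPieceUnif P V C := ⟨List.ofFn copy, List.ofFn unif⟩
  have hrel : ∀ s t, μ.rel s t → s.applySub φ = t.applySub φ := by
    intro s t hst
    refine applySub_eq_of_joinRel (fun r hr s t hrst => ?_) hst
    obtain ⟨m, hm, rfl⟩ := List.mem_map.1 hr
    obtain ⟨i, rfl⟩ := (List.mem_ofFn' _ _).1 hm
    exact inducedUnif_rel_applySub hrst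
  have hadm : RelAdmissible μ.rel := fun c c' hcc => FOTerm.const.inj (hrel _ _ hcc)
  have hμ : IsDisjPieceUnifier (𝒟 : Set (Finset (FOAtom P V C))) R μ := by
    refine ⟨by simp [μ], by simp [μ], fun i hi => ?_, fun i hi => ?_, fun i j hi hj hij => ?_,
      fun i hi h₁ h₂ => ?_, hadm⟩
    · have hi' : i < R.heads.length := by simpa [μ] using hi
      refine ⟨Q ⟨i, hi'⟩, hQD _ (Finset.mem_univ _), fun v => e (i, v), fun v w hvw => ?_, ?_⟩
      · exact (Prod.mk.inj (he hvw)).2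
      · simp [μ, copy]
    · have hi' : i < R.heads.length := by simpa [μ] using hi
      refine Finset.disjoint_left.2 fun v hv => ?_
      have hv' : v ∈ varsFS (copy ⟨i, hi'⟩) := by simpa [μ] using hv
      obtain ⟨w, rfl⟩ := copy_vars _ v hv'
      exact heR _
    · have hi' : i < R.heads.length := by simpa [μ] using hi
      have hj' : j < R.heads.length := by simpa [μ] using hj
      refine Finset.disjoint_left.2 fun v hv hvj => ?_
      have hv' : v ∈ varsFS (copy ⟨i, hi'⟩) := by simpa [μ] using hv
      have hvj' : v ∈ varsFS (copy ⟨j, hj'⟩) := by simpa [μ] using hvj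
      obtain ⟨w, rfl⟩ := copy_vars _ v hv'
      obtain ⟨w', hw'⟩ := copy_vars _ _ hvj'
      exact hij (Prod.mk.inj (he hw')).1
    · have hH : R.heads.get ⟨i, hi⟩ ∈ R.heads := List.get_mem _ _
      have φ_ex : ∀ z ∈ varsFS (R.heads.get ⟨i, hi⟩) \ varsFS R.body,
          φ z = FOTerm.var (f (0, z)) := fun z hz => by
        obtain ⟨hz, hzB⟩ := Finset.mem_sdiff.1 hz
        rw [hφR z (R.head_vars_subset hH hz), h'_ex z hzB]
      have := isPieceUnifier_inducedUnif (φ := φ) (F := F) (Q := copy ⟨i, hi⟩) (B := R.body)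
        (H := R.heads.get ⟨i, hi⟩) (fun a ha => ?_) (fun hhom => ?_) φ_body
        (fun z hz => ⟨_, φ_ex z hz, hfF _⟩) (fun z hz z' hz' hzz => ?_)
      · simpa [μ, unif] using this
      · obtain ⟨b, hb, rfl⟩ := Finset.mem_image.1 ha
        rw [φ_head _ hH, φ_copy ⟨i, hi⟩ b]
        exact hg ⟨i, hi⟩ b hb
      · refine hF _ (hQ ⟨i, hi⟩) ⟨g ⟨i, hi⟩, fun b hb => ?_⟩
        rw [← φ_copy]
        exact hhom _ (Finset.mem_image_of_mem _ hb)
      · rw [φ_ex z hz, φ_ex z' hz'] at hzz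
        exact (Prod.mk.inj (hf (FOTerm.var.inj hzz))).2
  obtain ⟨u, hu⟩ := exists_isAssocSub (Relation.EqvGen.is_equivalence _) hadm
  have φ_u : ∀ a : FOAtom P V C, (a.applySub u).applySub φ = a.applySub φ := fun a => by
    rw [FOAtom.applySub_applySub]
    exact FOAtom.applySub_congr fun v _ => (hrel _ _ (hu.2.1 (FOTerm.var v))).symm
  refine hF (betaRw R μ u) ⟨_, .step _ _ R μ u hD hR hμ hu, Finset.mem_insert_self _ _⟩
    ⟨φ, fun a ha => ?_⟩
  rcases mem_betaRw.1 ha with ⟨b, hb, rfl⟩ | ⟨i, h₁, h₂, b, hb, rfl⟩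
  · rw [φ_u]
    exact φ_body b hb
  · rw [φ_u]
    obtain ⟨hbQ, hb'⟩ := Finset.mem_sdiff.1 hb
    by_contra hbF
    refine hb' ?_
    simp only [μ, List.get_ofFn] at hbQ ⊢
    exact Finset.mem_filter.2 ⟨hbQ, hbF⟩

/-- `G` satisfies all triggers of rules of `ℛ` on `F`. -/
def SatisfiesTriggers [DecidableEq V] (ℛ : Set (DisjRule P V C))
    (F G : Finset (FOAtom P V C)) : Prop :=
  ∀ R ∈ ℛ, ∀ h : FOSubst V C, IsTrigger R h F → ∃ H ∈ R.heads, ∃ k : FOSubst V C,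
    (∀ v ∈ varsFS R.body, k v = h v) ∧ IsHom k H G

/-- A breadth-first chase step preserving the avoidance of rewritings. -/
theorem AvoidsRewritings.exists_satisfiesTriggers [DecidableEq P] [DecidableEq V]
    [DecidableEq C] [Infinite V] {ℛ : Set (DisjRule P V C)} (hfin : ℛ.Finite)
    {𝒬 : Finset (Finset (FOAtom P V C))} {F : Finset (FOAtom P V C)}
    (hF : AvoidsRewritings ℛ 𝒬 F) :
    ∃ G, F ⊆ G ∧ AvoidsRewritings ℛ 𝒬 G ∧ SatisfiesTriggers ℛ F G := by
  classical
  have main : ∀ T : Finset (DisjRule P V C × FOSubst V C),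
      (∀ x ∈ T, x.1 ∈ ℛ ∧ IsTrigger x.1 x.2 F) →
      ∃ G, F ⊆ G ∧ AvoidsRewritings ℛ 𝒬 G ∧ ∀ x ∈ T, ∃ H ∈ x.1.heads, ∃ h' : FOSubst V C,
        (∀ v ∈ varsFS x.1.body, h' v = x.2 v) ∧ IsHom h' H G := by
    intro T
    induction T using Finset.induction_on with
    | empty => exact fun _ => ⟨F, subset_rfl, hF, by simp⟩
    | insert x T _ ih =>
      intro hT
      obtain ⟨G, hFG, hG, hsat⟩ := ih fun y hy => hT y (Finset.mem_insert_of_mem hy)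
      obtain ⟨hx, hxF⟩ := hT x (Finset.mem_insert_self _ _)
      obtain ⟨G', hGG', hG', hx'⟩ := hG.exists_extension hx fun a ha => hFG (hxF a ha)
      refine ⟨G', hFG.trans hGG', hG', fun y hy => ?_⟩
      rcases Finset.mem_insert.1 hy with rfl | hy
      · exact hx'
      · obtain ⟨H, hH, h', h₁, h₂⟩ := hsat y hy
        exact ⟨H, hH, h', h₁, fun a ha => hGG' (h₂ a ha)⟩
  -- up to their values outside the body, there are finitely many triggers on `F`
  let restr : DisjRule P V C → FOSubst V C → FOSubst V C := fun R h v =>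
    if v ∈ varsFS R.body then h v else FOTerm.var v
  have restr_body : ∀ R h, ∀ v ∈ varsFS R.body, restr R h v = h v := fun R h v hv => if_pos hv
  have trigger_restr : ∀ R h, IsTrigger R h F → IsTrigger R (restr R h) F := by
    intro R h hh a ha
    rw [FOAtom.applySub_congr fun v hv => restr_body R h v (mem_varsFS.2 ⟨a, ha, hv⟩)]
    exact hh a ha
  have finite_restr : ∀ R : DisjRule P V C, {k | ∃ h, IsTrigger R h F ∧ k = restr R h}.Finite := by
    intro R
    let ext : (varsFS R.body → termsFS F) → FOSubst V C := fun k v =>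
      if hv : v ∈ varsFS R.body then (k ⟨v, hv⟩).1 else FOTerm.var v
    refine (Set.finite_range ext).subset ?_
    rintro _ ⟨h, hh, rfl⟩
    have hmem : ∀ v : varsFS R.body, h v ∈ termsFS F := by
      intro v
      obtain ⟨a, ha, hva⟩ := mem_varsFS.1 v.2
      exact mem_termsFS.2 ⟨_, hh a ha, mem_args_applySub hva⟩
    refine ⟨fun v => ⟨h v, hmem v⟩, funext fun v => ?_⟩
    by_cases hv : v ∈ varsFS R.body <;> simp [ext, restr, hv]
  have finite_all : {x : DisjRule P V C × FOSubst V C |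
      x.1 ∈ ℛ ∧ ∃ h, IsTrigger x.1 h F ∧ x.2 = restr x.1 h}.Finite := by
    refine (hfin.biUnion fun R _ => (finite_restr R).image fun k => (R, k)).subset ?_
    rintro ⟨R, k⟩ ⟨hR, hk⟩
    exact Set.mem_biUnion hR ⟨k, hk, rfl⟩
  obtain ⟨G, hFG, hG, hsat⟩ := main finite_all.toFinset (by
    rintro ⟨R, k⟩ hx
    obtain ⟨hR, h, hh, hk⟩ := finite_all.mem_toFinset.1 hx
    dsimp only at hk
    exact ⟨hR, hk ▸ trigger_restr R h hh⟩)
  refine ⟨G, hFG, hG, fun R hR h hh => ?_⟩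
  obtain ⟨H, hH, h', h₁, h₂⟩ :=
    hsat (R, restr R h) (finite_all.mem_toFinset.2 ⟨hR, h, hh, rfl⟩)
  exact ⟨H, hH, h', fun v hv => (h₁ v hv).trans (restr_body R h v hv), h₂⟩

/-- The canonical interpretation of the union of a sequence of fact bases. -/
def unionInterp (Fs : ℕ → Finset (FOAtom P V C)) (v : V) : Interp P V C where
  dom := FOTerm V C
  nonempty := ⟨FOTerm.var v⟩
  rel p l := ∃ n, (⟨p, l⟩ : FOAtom P V C) ∈ Fs n
  cst := FOTerm.const

theorem unionInterp_satAtom {Fs : ℕ → Finset (FOAtom P V C)} {v : V} {a : FOSubst V C}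
    {b : FOAtom P V C} :
    (unionInterp Fs v).satAtom a b ↔ ∃ n, b.applySub a ∈ Fs n := by
  have : (unionInterp Fs v).evalT a = FOTerm.applySub a := by
    funext t
    cases t <;> rfl
  change (unionInterp Fs v).rel b.pred (b.args.map ((unionInterp Fs v).evalT a)) ↔ _
  rw [this]
  rfl

theorem unionInterp_satFS {Fs : ℕ → Finset (FOAtom P V C)} (hFs : Monotone Fs) {v : V}
    {a : FOSubst V C} {S : Finset (FOAtom P V C)} :
    (unionInterp Fs v).satFS a S ↔ ∃ n, IsHom a S (Fs n) := by
  constructor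
  · intro h
    choose! n hn using fun b hb => unionInterp_satAtom.1 (h b hb)
    exact ⟨S.sup n, fun b hb => hFs (Finset.le_sup hb) (hn b hb)⟩
  · rintro ⟨n, hn⟩ b hb
    exact unionInterp_satAtom.2 ⟨n, hn b hb⟩

/-- A fact base avoiding all rewritings of `𝒬` does not entail `𝒬` together with `ℛ`. -/
theorem AvoidsRewritings.not_semEntails [DecidableEq P] [DecidableEq V] [DecidableEq C]
    [Infinite V] {ℛ : Set (DisjRule P V C)} (hfin : ℛ.Finite)
    {𝒬 : Finset (Finset (FOAtom P V C))} {F : Finset (FOAtom P V C)}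
    (hF : AvoidsRewritings ℛ 𝒬 F) :
    ¬ SemEntails F ℛ (𝒬 : Set (Finset (FOAtom P V C))) := by
  choose next hnext using fun G : {G // AvoidsRewritings ℛ 𝒬 G} =>
    G.2.exists_satisfiesTriggers hfin
  let Gs : ℕ → {G // AvoidsRewritings ℛ 𝒬 G} := fun n =>
    (fun G => ⟨next G, (hnext G).2.1⟩)^[n] ⟨F, hF⟩
  have Gs_succ : ∀ n, (Gs (n + 1)).1 = next (Gs n) := fun n => by
    simp only [Gs, Function.iterate_succ_apply']
  let Fs : ℕ → Finset (FOAtom P V C) := fun n => (Gs n).1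
  have mono : Monotone Fs := monotone_nat_of_le_succ fun n => by
    simp only [Fs, Gs_succ]
    exact (hnext (Gs n)).1
  obtain ⟨v₀⟩ : Nonempty V := inferInstance
  intro hsem
  obtain ⟨Q, hQ, a, ha⟩ := hsem (unionInterp Fs v₀)
    ⟨FOTerm.var, (unionInterp_satFS mono).2 ⟨0, fun b hb => by
      rw [FOAtom.applySub_var]
      exact hb⟩⟩ fun R hR h hh => by
    obtain ⟨n, hn⟩ := (unionInterp_satFS mono).1 hh
    obtain ⟨H, hH, h', h₁, h₂⟩ := (hnext (Gs n)).2.2 R hR h hn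
    refine ⟨H, hH, h', h₁, (unionInterp_satFS mono).2 ⟨n + 1, ?_⟩⟩
    simp only [Fs, Gs_succ]
    exact h₂
  obtain ⟨n, hn⟩ := (unionInterp_satFS mono).1 ha
  exact (Gs n).2 Q ⟨𝒬, .refl 𝒬, hQ⟩ ⟨a, hn⟩

/-- soundness and completeness of piece-rewriting: for a finite set `ℛ`
of disjunctive existential rules, a UCQ `𝒬` and any fact base `F`:
`F, ℛ ⊨ 𝒬` iff there is a piece-rewriting `𝒬'` of `𝒬` with `ℛ` such that `F ⊨ 𝒬'`. -/
theorem stmt8 {P V C : Type} [DecidableEq P] [DecidableEq V] [DecidableEq C] [Infinite V]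
    (ℛ : Set (DisjRule P V C)) (hfin : ℛ.Finite) (hWF : ∀ R ∈ ℛ, R.WF)
    (𝒬 : Finset (Finset (FOAtom P V C))) (F : Finset (FOAtom P V C)) :
    SemEntails F ℛ (↑𝒬 : Set (Finset (FOAtom P V C))) ↔
      ∃ 𝒬' : Finset (Finset (FOAtom P V C)),
        IsPieceRewriting ℛ 𝒬 𝒬' ∧ ∃ Q' ∈ 𝒬', EntailsFS F Q' := by
  constructor
  · intro h
    by_contra hcon
    refine AvoidsRewritings.not_semEntails hfin (fun Q hQ hFQ => hcon ?_) h
    obtain ⟨𝒬', h𝒬', hQ⟩ := hQ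
    exact ⟨𝒬', h𝒬', Q, hQ, hFQ⟩
  · rintro ⟨𝒬', h𝒬', Q, hQ, hFQ⟩ I hI hIR
    exact h𝒬'.sound hIR ⟨Q, hQ, Interp.modelsFB_of_entailsFS hFQ hI⟩
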